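/- arXiv:math/9803090 — 3 statements merged into one kernel-verified Lean document; each statement's English description precedes it below -/
import Mathlib

section
/- Set n := 2m. Let μ : ℂ^{2m} ⊗ ℂ^{2^m} → ℂ^{2^m} be the linear map (Clifford multiplication) determined by μ(e_j ⊗ v) = γ_j v, and let p : ℂ^{2m} ⊗ ℂ^{2^m} → ℂ^{2m} ⊗ ℂ^{2^m} be the linear map determined by p(e_j ⊗ v) = e_j ⊗ v + (1/n) Σ_{l=1}^{2m} ε_l · e_l ⊗ γ_l γ_j v. Then μ ∘ p = 0, p ∘ p = p, and p(w) = w if and only if μ(w) = 0; hence p is a linear projection of ℂ^{2m} ⊗ ℂ^{2^m} onto the kernel of μ. -/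
open Matrix Complex

noncomputable section

/-- The 2×2 matrix `U = [[i,0],[0,-i]]`. -/
def matU : Matrix (Fin 2) (Fin 2) ℂ := !![Complex.I, 0; 0, -Complex.I]

/-- The 2×2 matrix `V = [[0,i],[i,0]]`. -/
def matV : Matrix (Fin 2) (Fin 2) ℂ := !![0, Complex.I; Complex.I, 0]

/-- The 2×2 identity matrix `E`. -/
def matE : Matrix (Fin 2) (Fin 2) ℂ := !![1, 0; 0, 1]

/-- The 2×2 matrix `T = [[0,-i],[i,0]]`. -/
def matT : Matrix (Fin 2) (Fin 2) ℂ := !![0, -Complex.I; Complex.I, 0]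

/-- `epsC k j = ε_j`:  `-1` for `j ≤ k` and `1` for `j > k` (1-based index `j`). -/
def epsC (k j : ℕ) : ℂ := if j ≤ k then -1 else 1

/-- `tauC k j = τ_j`:  `i` for `j ≤ k` and `1` for `j > k` (1-based index `j`). -/
def tauC (k j : ℕ) : ℂ := if j ≤ k then Complex.I else 1

/-- The 2×2 factor sitting in slot `α` (0-based, slot `0` is the leftmost tensor factor)
of the iterated Kronecker product defining `γ_l` (1-based `l`): for `l = 2j-1` resp.
`l = 2j` this product is `E^{⊗(m-j)} ⊗ U ⊗ T^{⊗(j-1)}` resp. `E^{⊗(m-j)} ⊗ V ⊗ T^{⊗(j-1)}`. -/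
def gammaFac (m l : ℕ) (α : Fin m) : Matrix (Fin 2) (Fin 2) ℂ :=
  if (α : ℕ) < m - (l + 1) / 2 then matE
  else if (α : ℕ) = m - (l + 1) / 2 then (if l % 2 = 1 then matU else matV) else matT

/-- `γ_l = τ_l · (E^{⊗(m-j)} ⊗ U/V ⊗ T^{⊗(j-1)})` as a `2^m × 2^m` matrix whose rows and
columns are indexed by `Fin m → Fin 2` (identifying `ℂ^{2^m}` with the `m`-fold Kronecker
power of `ℂ²`, slot `0` being the leftmost factor). -/
def gammaM (m k l : ℕ) : Matrix (Fin m → Fin 2) (Fin m → Fin 2) ℂ :=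
  Matrix.of fun i i' => tauC k l * ∏ α, gammaFac m l α (i α) (i' α)

/-- `u(δ) = (1/√2)(1, -δ i) ∈ ℂ²`. -/
def uVec (δ : ℤ) : Fin 2 → ℂ :=
  fun t => if t = 0 then (Real.sqrt 2 : ℂ)⁻¹ else -(δ : ℂ) * Complex.I * (Real.sqrt 2 : ℂ)⁻¹

/-- `u(δ₁,…,δ_m) = u(δ₁) ⊗ ⋯ ⊗ u(δ_m) ∈ ℂ^{2^m}`. -/
def uProd (m : ℕ) (δ : Fin m → ℤ) : (Fin m → Fin 2) → ℂ :=
  fun i => ∏ α, uVec (δ α) (i α)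

/-- The standard Hermitian inner product, conjugate-linear in the second argument. -/
def hermIP {ι : Type*} [Fintype ι] (x y : ι → ℂ) : ℂ :=
  ∑ i, x i * (starRingEnd ℂ) (y i)

/-- The product `γ_1 γ_2 ⋯ γ_{2m}`. -/
def gammaVol (m k : ℕ) : Matrix (Fin m → Fin 2) (Fin m → Fin 2) ℂ :=
  ((List.range (2 * m)).map fun l => gammaM m k (l + 1)).prod

/-- The eigenspace `Δ^ε_{2m,k}` of `γ_1 γ_2 ⋯ γ_{2m}` for the eigenvalue `ε · i^{m+k}`. -/
def DeltaSp (m k : ℕ) (ε : ℤ) : Submodule ℂ ((Fin m → Fin 2) → ℂ) :=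
  Module.End.eigenspace (Matrix.toLin' (gammaVol m k)) ((ε : ℂ) * Complex.I ^ (m + k))

/-- The indefinite inner product `⟨u,v⟩ := (γ_1 u, v)` (here `k = 1`). -/
def indefIP (m : ℕ) (u v : (Fin m → Fin 2) → ℂ) : ℂ :=
  hermIP ((gammaM m 1 1).mulVec u) v

/-- The canonical vector `V_u` of a spinor `u`, with components
`(V_u)_j = -ε_j ⟨γ_j u, u⟩` (here `k = 1`). -/
def canV (m : ℕ) (u : (Fin m → Fin 2) → ℂ) : Fin (2 * m) → ℂ :=
  fun j => -(epsC 1 ((j : ℕ) + 1)) * indefIP m ((gammaM m 1 ((j : ℕ) + 1)).mulVec u) u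

/-- `x ⊗ v` under the identification `ℂ^{2^{n+1}} = ℂ^{2^n} ⊗ ℂ²` (the `ℂ²` factor last). -/
def tensP (n : ℕ) (x : (Fin n → Fin 2) → ℂ) (v : Fin 2 → ℂ) : (Fin (n + 1) → Fin 2) → ℂ :=
  fun i => x (Fin.init i) * v (i (Fin.last n))

/-- `Ω₀ = Σ_α γ'_{2α-1} γ'_{2α}` (here `k = 0`). -/
def OmegaZero (n : ℕ) : Matrix (Fin n → Fin 2) (Fin n → Fin 2) ℂ :=
  ∑ α : Fin n, gammaM n 0 (2 * (α : ℕ) + 1) * gammaM n 0 (2 * (α : ℕ) + 2)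

end
noncomputable section

open TensorProduct

/-- The linear map `ℂ^{2m} → M(2^m, ℂ)` sending `x` to `γ(x) = Σ_j x_j γ_j`. -/
def gammaLin (m k : ℕ) : (Fin (2 * m) → ℂ) →ₗ[ℂ] Matrix (Fin m → Fin 2) (Fin m → Fin 2) ℂ :=
  ∑ j : Fin (2 * m), (LinearMap.proj j).smulRight (gammaM m k ((j : ℕ) + 1))

/-- Clifford multiplication `μ : ℂ^{2m} ⊗ ℂ^{2^m} → ℂ^{2^m}`, the linear map
determined by `μ(e_j ⊗ v) = γ_j v`. -/
def muMap (m k : ℕ) :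
    ((Fin (2 * m) → ℂ) ⊗[ℂ] ((Fin m → Fin 2) → ℂ)) →ₗ[ℂ] ((Fin m → Fin 2) → ℂ) :=
  TensorProduct.lift ((Matrix.toLin'.toLinearMap).comp (gammaLin m k))

/-- The linear map `p : ℂ^{2m} ⊗ ℂ^{2^m} → ℂ^{2m} ⊗ ℂ^{2^m}` determined by
`p(e_j ⊗ v) = e_j ⊗ v + (1/n) Σ_l ε_l · e_l ⊗ γ_l γ_j v` (with `n = 2m`). -/
def pMap (m k : ℕ) :
    ((Fin (2 * m) → ℂ) ⊗[ℂ] ((Fin m → Fin 2) → ℂ)) →ₗ[ℂ]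
      ((Fin (2 * m) → ℂ) ⊗[ℂ] ((Fin m → Fin 2) → ℂ)) :=
  LinearMap.id + ((2 * m : ℂ))⁻¹ • ∑ l : Fin (2 * m), epsC k ((l : ℕ) + 1) •
    ((TensorProduct.mk ℂ (Fin (2 * m) → ℂ) ((Fin m → Fin 2) → ℂ)
        (Pi.single l 1)).comp
      ((Matrix.toLin' (gammaM m k ((l : ℕ) + 1))).comp (muMap m k)))

end

lemma epsC_mul_tauC_mul_self (k l : ℕ) : epsC k l * (tauC k l * tauC k l) = 1 := by
  unfold epsC tauC
  split_ifs <;> simp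

lemma gammaFac_mul_self (m l : ℕ) (α : Fin m) :
    gammaFac m l α * gammaFac m l α =
      (if (α : ℕ) = m - (l + 1) / 2 then (-1 : ℂ) else 1) • 1 := by
  unfold gammaFac
  split_ifs <;> first
    | omega
    | (ext a b
       fin_cases a <;> fin_cases b <;>
         simp [matE, matU, matV, matT, Matrix.mul_apply, Fin.sum_univ_two])

lemma gammaM_mul_self {m l : ℕ} (k : ℕ) (hl : 1 ≤ l) (hlm : l ≤ 2 * m) :
    gammaM m k l * gammaM m k l = (-(tauC k l * tauC k l)) • 1 := by
  have hsign : ∏ α : Fin m, (if (α : ℕ) = m - (l + 1) / 2 then (-1 : ℂ) else 1) = -1 := by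
    have h : ∀ α : Fin m, (α : ℕ) = m - (l + 1) / 2 ↔ α = ⟨m - (l + 1) / 2, by omega⟩ :=
      fun α => by rw [Fin.ext_iff]
    simp only [h, Finset.prod_ite_eq', Finset.mem_univ, if_true]
  have hone (i i' : Fin m → Fin 2) :
      ∏ α, (1 : Matrix (Fin 2) (Fin 2) ℂ) (i α) (i' α) =
        (1 : Matrix (Fin m → Fin 2) (Fin m → Fin 2) ℂ) i i' := by
    simp only [Matrix.one_apply, Finset.prod_ite_zero, Finset.prod_const_one, Finset.mem_univ,
      true_implies, funext_iff]
  ext i i'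
  calc (gammaM m k l * gammaM m k l) i i'
      = tauC k l * tauC k l *
          ∑ j : Fin m → Fin 2, ∏ α, gammaFac m l α (i α) (j α) * gammaFac m l α (j α) (i' α) := by
        simp only [Matrix.mul_apply, gammaM, Matrix.of_apply, Finset.mul_sum,
          Finset.prod_mul_distrib]
        exact Finset.sum_congr rfl fun j _ => by ring
    _ = tauC k l * tauC k l * ∏ α, (gammaFac m l α * gammaFac m l α) (i α) (i' α) := by
        simp only [Matrix.mul_apply, Finset.prod_univ_sum, Fintype.piFinset_univ]
    _ = ((-(tauC k l * tauC k l)) • (1 : Matrix (Fin m → Fin 2) (Fin m → Fin 2) ℂ)) i i' := by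
        simp only [gammaFac_mul_self, Matrix.smul_apply, smul_eq_mul, Finset.prod_mul_distrib,
          hsign, hone]
        ring

lemma muMap_single_tmul (m k : ℕ) (j : Fin (2 * m)) (v : (Fin m → Fin 2) → ℂ) :
    muMap m k (TensorProduct.tmul ℂ (Pi.single j 1) v) =
      (gammaM m k ((j : ℕ) + 1)).mulVec v := by
  have h : gammaLin m k (Pi.single j 1) = gammaM m k ((j : ℕ) + 1) := by
    simp [gammaLin, LinearMap.sum_apply, Pi.single_apply, ite_smul]
  simp [muMap, h]

lemma pMap_apply (m k : ℕ) (w : TensorProduct ℂ (Fin (2 * m) → ℂ) ((Fin m → Fin 2) → ℂ)) :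
    pMap m k w = w + (2 * m : ℂ)⁻¹ • ∑ l : Fin (2 * m), epsC k ((l : ℕ) + 1) •
      TensorProduct.tmul ℂ (Pi.single l (1 : ℂ))
        ((gammaM m k ((l : ℕ) + 1)).mulVec (muMap m k w)) := by
  simp [pMap, LinearMap.sum_apply]

lemma muMap_pMap {m : ℕ} (k : ℕ) (hm : 1 ≤ m)
    (w : TensorProduct ℂ (Fin (2 * m) → ℂ) ((Fin m → Fin 2) → ℂ)) :
    muMap m k (pMap m k w) = 0 := by
  have hterm (l : Fin (2 * m)) : epsC k ((l : ℕ) + 1) • (gammaM m k ((l : ℕ) + 1)).mulVec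
      ((gammaM m k ((l : ℕ) + 1)).mulVec (muMap m k w)) = -muMap m k w := by
    rw [Matrix.mulVec_mulVec, gammaM_mul_self k (by omega) (by omega), Matrix.smul_mulVec,
      Matrix.one_mulVec, smul_smul, mul_neg, epsC_mul_tauC_mul_self, neg_one_smul]
  have hm0 : (2 * m : ℂ) ≠ 0 := by
    exact_mod_cast (by omega : 2 * m ≠ 0)
  rw [pMap_apply, map_add, map_smul, map_sum]
  simp only [map_smul, muMap_single_tmul, hterm, Finset.sum_const, Finset.card_univ,
    Fintype.card_fin, ← Nat.cast_smul_eq_nsmul ℂ, Nat.cast_mul, Nat.cast_ofNat, smul_neg,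
    inv_smul_smul₀ hm0, add_neg_cancel]

lemma pMap_eq_self_of_muMap_eq_zero {m k : ℕ}
    {w : TensorProduct ℂ (Fin (2 * m) → ℂ) ((Fin m → Fin 2) → ℂ)} (hw : muMap m k w = 0) :
    pMap m k w = w := by
  simp [pMap_apply, hw]

open TensorProduct in
/-- with `n = 2m`, `μ(e_j ⊗ v) = γ_j v` and
`p(e_j ⊗ v) = e_j ⊗ v + (1/n) Σ_l ε_l e_l ⊗ γ_l γ_j v`; then `μ ∘ p = 0`, `p ∘ p = p`,
`p w = w ↔ μ w = 0`, and `p` is a linear projection onto the kernel of `μ`. -/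
theorem pMap_projection_onto_ker_mu (m k : ℕ) (hm : 1 ≤ m) (hk : k ≤ 2 * m) :
    (∀ (j : Fin (2 * m)) (v : (Fin m → Fin 2) → ℂ),
      muMap m k (Pi.single j 1 ⊗ₜ[ℂ] v) = (gammaM m k ((j : ℕ) + 1)).mulVec v) ∧
    (∀ (j : Fin (2 * m)) (v : (Fin m → Fin 2) → ℂ),
      pMap m k (Pi.single j 1 ⊗ₜ[ℂ] v) =
        Pi.single j 1 ⊗ₜ[ℂ] v + ∑ l : Fin (2 * m),
          (((2 * m : ℂ))⁻¹ * epsC k ((l : ℕ) + 1)) •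
            (Pi.single l (1 : ℂ) ⊗ₜ[ℂ]
              (gammaM m k ((l : ℕ) + 1) * gammaM m k ((j : ℕ) + 1)).mulVec v)) ∧
    (muMap m k).comp (pMap m k) = 0 ∧
    (pMap m k).comp (pMap m k) = pMap m k ∧
    (∀ w, pMap m k w = w ↔ muMap m k w = 0) ∧
    LinearMap.range (pMap m k) = LinearMap.ker (muMap m k) := by
  refine ⟨muMap_single_tmul m k, fun j v => ?_, LinearMap.ext (muMap_pMap k hm),
    LinearMap.ext fun w => pMap_eq_self_of_muMap_eq_zero (muMap_pMap k hm w),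
    fun w => ⟨fun h => h ▸ muMap_pMap k hm w, pMap_eq_self_of_muMap_eq_zero⟩, ?_⟩
  · simp only [pMap_apply, muMap_single_tmul, Matrix.mulVec_mulVec, Finset.smul_sum, smul_smul]
  · apply le_antisymm
    · rintro _ ⟨w, rfl⟩
      exact muMap_pMap k hm w
    · exact fun w hw => ⟨w, pMap_eq_self_of_muMap_eq_zero hw⟩
end

section
/- For every x, y ∈ ℂ^{2^n}, writing w := x ⊗ u(1) + y ⊗ u(−1) ∈ ℂ^{2^{n+1}}: χ(γ_1 w) = (−y, −x), χ(γ_2 w) = (−y, x), and χ(γ_l w) = (−γ'_{l−2} x, γ'_{l−2} y) for every 3 ≤ l ≤ 2n+2. Consequently, for the isotropic vectors N := (e_1 + e_2)/√2 and T* := (e_2 − e_1)/√2 of ℝ^{2n+2}, χ(γ(N) w) = (−√2·y, 0) and χ(γ(T*) w) = (0, √2·x), where γ(x) := Σ_j x_j γ_j. -/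
open Matrix Complex

/-- A matrix which is a Kronecker product (last factor acting on `ℂ²`) acts factorwise. -/
lemma mulVec_tensP (n : ℕ) (M : Matrix (Fin (n + 1) → Fin 2) (Fin (n + 1) → Fin 2) ℂ)
    (A : Matrix (Fin n → Fin 2) (Fin n → Fin 2) ℂ) (B : Matrix (Fin 2) (Fin 2) ℂ)
    (h : ∀ i i', M i i' = A (Fin.init i) (Fin.init i') * B (i (Fin.last n)) (i' (Fin.last n)))
    (x : (Fin n → Fin 2) → ℂ) (v : Fin 2 → ℂ) :
    M.mulVec (tensP n x v) = tensP n (A.mulVec x) (B.mulVec v) := by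
  ext i
  simp only [Matrix.mulVec, dotProduct, tensP, h]
  rw [← (Fin.snocEquiv fun _ => Fin 2).sum_comp, Fintype.sum_prod_type, Finset.sum_comm,
    Finset.sum_mul_sum]
  refine Finset.sum_congr rfl fun a _ => Finset.sum_congr rfl fun b _ => ?_
  simp only [Fin.snocEquiv, Equiv.coe_fn_mk, Fin.init_snoc, Fin.snoc_last]
  ring

lemma matE_eq_one : matE = 1 := by
  simp [matE, Matrix.one_fin_two]

lemma prod_matE (n : ℕ) (i i' : Fin n → Fin 2) :
    ∏ α, matE (i α) (i' α) = (1 : Matrix (Fin n → Fin 2) (Fin n → Fin 2) ℂ) i i' := by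
  simp only [matE_eq_one, Matrix.one_apply, Finset.prod_ite_zero, Finset.prod_const_one,
    Finset.mem_univ, forall_const, funext_iff]

lemma gammaM_one_mulVec_tensP (n : ℕ) (x : (Fin n → Fin 2) → ℂ) (v : Fin 2 → ℂ) :
    (gammaM (n + 1) 1 1).mulVec (tensP n x v) =
      tensP n x ((Complex.I • matU).mulVec v) := by
  rw [mulVec_tensP n _ 1 (Complex.I • matU), Matrix.one_mulVec]
  intro i i'
  rw [← prod_matE]
  simp only [gammaM, Matrix.of_apply, Fin.prod_univ_castSucc]
  simp [gammaFac, tauC, Fin.init]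
  ring

lemma gammaM_two_mulVec_tensP (n : ℕ) (x : (Fin n → Fin 2) → ℂ) (v : Fin 2 → ℂ) :
    (gammaM (n + 1) 1 2).mulVec (tensP n x v) = tensP n x (matV.mulVec v) := by
  rw [mulVec_tensP n _ 1 matV, Matrix.one_mulVec]
  intro i i'
  rw [← prod_matE]
  simp only [gammaM, Matrix.of_apply, Fin.prod_univ_castSucc]
  simp [gammaFac, tauC, Fin.init]

lemma gammaFac_castSucc (n l : ℕ) (hl : 3 ≤ l) (α : Fin n) :
    gammaFac (n + 1) l α.castSucc = gammaFac n (l - 2) α := by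
  have h : n + 1 - (l + 1) / 2 = n - (l - 2 + 1) / 2 := by omega
  have h' : (l - 2) % 2 = l % 2 := by omega
  simp only [gammaFac, Fin.val_castSucc, h, h']

lemma gammaFac_last (n l : ℕ) (hl : 3 ≤ l) (hn : 1 ≤ n) :
    gammaFac (n + 1) l (Fin.last n) = matT := by
  have h₁ : ¬ n < n + 1 - (l + 1) / 2 := by omega
  have h₂ : ¬ n = n + 1 - (l + 1) / 2 := by omega
  simp only [gammaFac, Fin.val_last, if_neg h₁, if_neg h₂]

lemma gammaM_mulVec_tensP (n l : ℕ) (hn : 1 ≤ n) (hl : 3 ≤ l)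
    (x : (Fin n → Fin 2) → ℂ) (v : Fin 2 → ℂ) :
    (gammaM (n + 1) 1 l).mulVec (tensP n x v) =
      tensP n ((gammaM n 0 (l - 2)).mulVec x) (matT.mulVec v) := by
  refine mulVec_tensP n _ _ _ (fun i i' => ?_) x v
  have h₁ : ¬ l ≤ 1 := by omega
  have h₂ : ¬ l - 2 ≤ 0 := by omega
  simp only [gammaM, Matrix.of_apply, Fin.prod_univ_castSucc, gammaFac_castSucc n l hl,
    gammaFac_last n l hl hn, tauC, if_neg h₁, if_neg h₂, one_mul, Fin.init]

lemma I_smul_matU_mulVec_uVec (δ : ℤ) :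
    (Complex.I • matU).mulVec (uVec δ) = -uVec (-δ) := by
  ext t
  fin_cases t <;> simp [matU, uVec, Matrix.mulVec, dotProduct, ← mul_assoc]

lemma matV_mulVec_uVec_one : matV.mulVec (uVec 1) = uVec (-1) := by
  ext t
  fin_cases t <;> simp [matV, uVec, Matrix.mulVec, dotProduct, ← mul_assoc]

lemma matV_mulVec_uVec_neg_one : matV.mulVec (uVec (-1)) = -uVec 1 := by
  ext t
  fin_cases t <;> simp [matV, uVec, Matrix.mulVec, dotProduct, ← mul_assoc]

lemma matT_mulVec_uVec_one : matT.mulVec (uVec 1) = -uVec 1 := by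
  ext t
  fin_cases t <;> simp [matT, uVec, Matrix.mulVec, dotProduct, ← mul_assoc]

lemma matT_mulVec_uVec_neg_one : matT.mulVec (uVec (-1)) = uVec (-1) := by
  ext t
  fin_cases t <;> simp [matT, uVec, Matrix.mulVec, dotProduct, ← mul_assoc]

lemma inv_sqrt_two_mul_two : (Real.sqrt 2 : ℂ)⁻¹ * 2 = (Real.sqrt 2 : ℂ) := by
  have h : (Real.sqrt 2 : ℂ) * (Real.sqrt 2 : ℂ) = 2 := by
    rw [← Complex.ofReal_mul, Real.mul_self_sqrt (by norm_num), Complex.ofReal_ofNat]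
  have h₀ : (Real.sqrt 2 : ℂ) ≠ 0 := by
    rintro h'
    simp [h'] at h
  rw [← h, inv_mul_cancel_left₀ h₀]

/-- under the identification `χ(x ⊗ u(1) + y ⊗ u(-1)) = (x,y)`, the
Clifford multiplications by `γ_1`, `γ_2`, `γ_l` (`3 ≤ l ≤ 2n+2`) and by the isotropic
vectors `N = (e₁+e₂)/√2`, `T* = (e₂-e₁)/√2` are as stated. -/
theorem gamma_action_on_split_spinors (n : ℕ) (hn : 1 ≤ n)
    (x y : (Fin n → Fin 2) → ℂ) (w : (Fin (n + 1) → Fin 2) → ℂ)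
    (hw : w = tensP n x (uVec 1) + tensP n y (uVec (-1))) :
    (gammaM (n + 1) 1 1).mulVec w =
      tensP n (-y) (uVec 1) + tensP n (-x) (uVec (-1)) ∧
    (gammaM (n + 1) 1 2).mulVec w =
      tensP n (-y) (uVec 1) + tensP n x (uVec (-1)) ∧
    (∀ l : ℕ, 3 ≤ l → l ≤ 2 * n + 2 →
      (gammaM (n + 1) 1 l).mulVec w =
        tensP n (-(gammaM n 0 (l - 2)).mulVec x) (uVec 1) +
          tensP n ((gammaM n 0 (l - 2)).mulVec y) (uVec (-1))) ∧
    (((Real.sqrt 2 : ℂ))⁻¹ • (gammaM (n + 1) 1 1 + gammaM (n + 1) 1 2)).mulVec w =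
      tensP n ((-(Real.sqrt 2 : ℂ)) • y) (uVec 1) + tensP n 0 (uVec (-1)) ∧
    (((Real.sqrt 2 : ℂ))⁻¹ • (gammaM (n + 1) 1 2 - gammaM (n + 1) 1 1)).mulVec w =
      tensP n 0 (uVec 1) + tensP n ((Real.sqrt 2 : ℂ) • x) (uVec (-1)) := by
  subst hw
  have h₁ : (gammaM (n + 1) 1 1).mulVec (tensP n x (uVec 1) + tensP n y (uVec (-1))) =
      tensP n (-y) (uVec 1) + tensP n (-x) (uVec (-1)) := by
    rw [Matrix.mulVec_add, gammaM_one_mulVec_tensP, gammaM_one_mulVec_tensP,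
      I_smul_matU_mulVec_uVec, I_smul_matU_mulVec_uVec, neg_neg]
    ext i
    simp only [tensP, Pi.add_apply, Pi.neg_apply]
    ring
  have h₂ : (gammaM (n + 1) 1 2).mulVec (tensP n x (uVec 1) + tensP n y (uVec (-1))) =
      tensP n (-y) (uVec 1) + tensP n x (uVec (-1)) := by
    rw [Matrix.mulVec_add, gammaM_two_mulVec_tensP, gammaM_two_mulVec_tensP,
      matV_mulVec_uVec_one, matV_mulVec_uVec_neg_one]
    ext i
    simp only [tensP, Pi.add_apply, Pi.neg_apply]
    ring
  refine ⟨h₁, h₂, fun l hl _ => ?_, ?_, ?_⟩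
  · rw [Matrix.mulVec_add, gammaM_mulVec_tensP n l hn hl, gammaM_mulVec_tensP n l hn hl,
      matT_mulVec_uVec_one, matT_mulVec_uVec_neg_one]
    ext i
    simp only [tensP, Pi.add_apply, Pi.neg_apply]
    ring
  · rw [Matrix.smul_mulVec, Matrix.add_mulVec, h₁, h₂]
    ext i
    simp only [tensP, Pi.add_apply, Pi.neg_apply, Pi.smul_apply, Pi.zero_apply, smul_eq_mul]
    linear_combination (-(y (Fin.init i) * uVec 1 (i (Fin.last n)))) * inv_sqrt_two_mul_two
  · rw [Matrix.smul_mulVec, Matrix.sub_mulVec, h₁, h₂]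
    ext i
    simp only [tensP, Pi.add_apply, Pi.sub_apply, Pi.neg_apply, Pi.smul_apply, Pi.zero_apply,
      smul_eq_mul]
    linear_combination (x (Fin.init i) * uVec (-1) (i (Fin.last n))) * inv_sqrt_two_mul_two
end

section
/- For every x, y ∈ ℂ^{2^n}, writing w := x ⊗ u(1) + y ⊗ u(−1) ∈ ℂ^{2^{n+1}} and ω' := γ'_1 γ'_2 ⋯ γ'_{2n}: χ(γ_1 γ_2 ⋯ γ_{2n+2} w) = (−ω' x, ω' y). Consequently χ maps the eigenspace Δ^+_{2n+2,1} of γ_1⋯γ_{2n+2} for eigenvalue i^{n+2} onto Δ^+_{2n,0} ⊕ Δ^−_{2n,0}, and Δ^−_{2n+2,1} onto Δ^−_{2n,0} ⊕ Δ^+_{2n,0}, where Δ^±_{2n,0} is the eigenspace of ω' for eigenvalue ±i^n. -/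
open Matrix Complex

/-- The Kronecker product of a `2^n × 2^n` matrix with a `2 × 2` matrix, acting on
`ℂ^{2^{n+1}} = ℂ^{2^n} ⊗ ℂ²`. -/
def tensM (n : ℕ) (A : Matrix (Fin n → Fin 2) (Fin n → Fin 2) ℂ)
    (B : Matrix (Fin 2) (Fin 2) ℂ) :
    Matrix (Fin (n + 1) → Fin 2) (Fin (n + 1) → Fin 2) ℂ :=
  Matrix.of fun i i' => A (Fin.init i) (Fin.init i') * B (i (Fin.last n)) (i' (Fin.last n))

theorem tensM_mulVec_tensP (n : ℕ) (A : Matrix (Fin n → Fin 2) (Fin n → Fin 2) ℂ)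
    (B : Matrix (Fin 2) (Fin 2) ℂ) (x : (Fin n → Fin 2) → ℂ) (v : Fin 2 → ℂ) :
    (tensM n A B).mulVec (tensP n x v) = tensP n (A.mulVec x) (B.mulVec v) := by
  funext i
  simp only [Matrix.mulVec, dotProduct, tensM, tensP, Matrix.of_apply]
  rw [← (Fin.snocEquiv fun _ : Fin (n + 1) => Fin 2).sum_comp, Fintype.sum_prod_type,
    Finset.sum_mul_sum, Finset.sum_comm]
  refine Finset.sum_congr rfl fun j _ => Finset.sum_congr rfl fun t _ => ?_
  have ht : (Fin.snocEquiv fun _ : Fin (n + 1) => Fin 2) (t, j) (Fin.last n) = t :=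
    Fin.snoc_last (α := fun _ : Fin (n + 1) => Fin 2) t j
  have hj : Fin.init ((Fin.snocEquiv fun _ : Fin (n + 1) => Fin 2) (t, j)) = j :=
    Fin.init_snoc (α := fun _ : Fin (n + 1) => Fin 2) t j
  rw [ht, hj]
  ring

theorem tensP_smul_left (n : ℕ) (c : ℂ) (x : (Fin n → Fin 2) → ℂ) (v : Fin 2 → ℂ) :
    tensP n (c • x) v = c • tensP n x v := by
  funext i
  simp [tensP, mul_assoc]

theorem tensP_smul_right (n : ℕ) (c : ℂ) (x : (Fin n → Fin 2) → ℂ) (v : Fin 2 → ℂ) :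
    tensP n x (c • v) = c • tensP n x v := by
  funext i
  simp [tensP, mul_left_comm]

theorem prod_matE_apply {ι : Type*} [Fintype ι] [DecidableEq ι] (i i' : ι → Fin 2) :
    ∏ α, matE (i α) (i' α) = (1 : Matrix (ι → Fin 2) (ι → Fin 2) ℂ) i i' := by
  have hE : matE = 1 := Matrix.one_fin_two.symm
  simp only [hE, Matrix.one_apply, Finset.prod_ite_zero, Finset.prod_const_one, funext_iff,
    Finset.mem_univ, true_imp_iff]

theorem gammaM_succ_one_one (n : ℕ) :
    gammaM (n + 1) 1 1 = tensM n 1 (Complex.I • matU) := by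
  ext i i'
  simp only [gammaM, tensM, Matrix.of_apply, Fin.prod_univ_castSucc, ← prod_matE_apply]
  simp [gammaFac, tauC, Fin.init, mul_left_comm]

theorem gammaM_succ_one_two (n : ℕ) : gammaM (n + 1) 1 2 = tensM n 1 matV := by
  ext i i'
  simp only [gammaM, tensM, Matrix.of_apply, Fin.prod_univ_castSucc, ← prod_matE_apply]
  simp [gammaFac, tauC, Fin.init]

theorem gammaFac_succ_castSucc (n l : ℕ) (α : Fin n) :
    gammaFac (n + 1) (l + 2) α.castSucc = gammaFac n l α := by
  have h : n + 1 - (l + 2 + 1) / 2 = n - (l + 1) / 2 := by omega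
  simp only [gammaFac, h, Fin.val_castSucc, Nat.add_mod_right]

theorem gammaFac_succ_last (n l : ℕ) (hn : 1 ≤ n) (hl : 1 ≤ l) :
    gammaFac (n + 1) (l + 2) (Fin.last n) = matT := by
  have h₁ : ¬ n < n + 1 - (l + 2 + 1) / 2 := by omega
  have h₂ : ¬ n = n + 1 - (l + 2 + 1) / 2 := by omega
  simp only [gammaFac, Fin.val_last, if_neg h₁, if_neg h₂]

theorem gammaM_succ_one_add_two (n l : ℕ) (hn : 1 ≤ n) (hl : 1 ≤ l) :
    gammaM (n + 1) 1 (l + 2) = tensM n (gammaM n 0 l) matT := by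
  have h₁ : ¬ l + 2 ≤ 1 := by omega
  have h₂ : ¬ l ≤ 0 := by omega
  ext i i'
  simp only [gammaM, tensM, Matrix.of_apply, Fin.prod_univ_castSucc, gammaFac_succ_castSucc,
    gammaFac_succ_last n l hn hl, tauC, if_neg h₁, if_neg h₂, one_mul, Fin.init]

theorem prod_gammaM_mulVec_tensP (n : ℕ) (hn : 1 ≤ n) (L : List ℕ) (x : (Fin n → Fin 2) → ℂ)
    (v : Fin 2 → ℂ) :
    ((L.map fun l => gammaM (n + 1) 1 (l + 1 + 2)).prod).mulVec (tensP n x v) =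
      tensP n (((L.map fun l => gammaM n 0 (l + 1)).prod).mulVec x)
        ((matT ^ L.length).mulVec v) := by
  induction L with
  | nil => simp
  | cons l L ih =>
    simp only [List.map_cons, List.prod_cons, List.length_cons, pow_succ', ← Matrix.mulVec_mulVec,
      ih, gammaM_succ_one_add_two n (l + 1) hn (by omega), tensM_mulVec_tensP]

theorem matT_sq : matT ^ 2 = 1 := by
  ext a b
  fin_cases a <;> fin_cases b <;> simp [matT, pow_two]

theorem I_smul_matU_mul_matV : (Complex.I • matU) * matV = matT := by
  ext a b
  fin_cases a <;> fin_cases b <;> simp [matT, matU, matV]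

theorem gammaVol_succ_one_mulVec_tensP (n : ℕ) (hn : 1 ≤ n) (x : (Fin n → Fin 2) → ℂ)
    (v : Fin 2 → ℂ) :
    (gammaVol (n + 1) 1).mulVec (tensP n x v) =
      tensP n ((gammaVol n 0).mulVec x) (matT.mulVec v) := by
  have h : gammaVol (n + 1) 1 = gammaM (n + 1) 1 1 * (gammaM (n + 1) 1 2 *
      ((List.range (2 * n)).map fun l => gammaM (n + 1) 1 (l + 1 + 2)).prod) := by
    simp only [gammaVol, Nat.mul_succ, List.range_succ_eq_map, List.map_cons, List.map_map,
      List.prod_cons]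
    rfl
  rw [h, ← Matrix.mulVec_mulVec, ← Matrix.mulVec_mulVec, prod_gammaM_mulVec_tensP n hn,
    gammaM_succ_one_one, gammaM_succ_one_two, tensM_mulVec_tensP, tensM_mulVec_tensP,
    List.length_range, pow_mul, matT_sq, one_pow, Matrix.one_mulVec, Matrix.one_mulVec,
    Matrix.one_mulVec, Matrix.mulVec_mulVec, I_smul_matU_mul_matV, gammaVol]

theorem matT_mulVec_uVec {δ : ℤ} (hδ : δ * δ = 1) :
    matT.mulVec (uVec δ) = (-(δ : ℂ)) • uVec δ := by
  have hδ' : (δ : ℂ) * δ = 1 := by exact_mod_cast hδ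
  funext a
  fin_cases a
  · simp [matT, uVec, Matrix.mulVec, dotProduct]
    linear_combination (δ : ℂ) * (Real.sqrt 2 : ℂ)⁻¹ * Complex.I_mul_I
  · simp [matT, uVec, Matrix.mulVec, dotProduct]
    linear_combination -(Complex.I * (Real.sqrt 2 : ℂ)⁻¹) * hδ'

theorem gammaVol_succ_one_mulVec_split (n : ℕ) (hn : 1 ≤ n) (x y : (Fin n → Fin 2) → ℂ) :
    (gammaVol (n + 1) 1).mulVec (tensP n x (uVec 1) + tensP n y (uVec (-1))) =
      tensP n (-(gammaVol n 0).mulVec x) (uVec 1) +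
        tensP n ((gammaVol n 0).mulVec y) (uVec (-1)) := by
  rw [Matrix.mulVec_add, gammaVol_succ_one_mulVec_tensP n hn, gammaVol_succ_one_mulVec_tensP n hn,
    matT_mulVec_uVec (by norm_num), matT_mulVec_uVec (by norm_num), tensP_smul_right,
    tensP_smul_right, ← tensP_smul_left, ← tensP_smul_left]
  simp

theorem tensP_split_injective (n : ℕ) {x y x' y' : (Fin n → Fin 2) → ℂ}
    (h : tensP n x (uVec 1) + tensP n y (uVec (-1)) =
      tensP n x' (uVec 1) + tensP n y' (uVec (-1))) : x = x' ∧ y = y' := by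
  have hs : (Real.sqrt 2 : ℂ)⁻¹ ≠ 0 := by simp
  have key : ∀ i, x i + y i = x' i + y' i ∧ x i - y i = x' i - y' i := by
    intro i
    have h₀ := congrFun h (Fin.snoc (α := fun _ => Fin 2) i 0)
    have h₁ := congrFun h (Fin.snoc (α := fun _ => Fin 2) i 1)
    simp only [tensP, uVec, Pi.add_apply, Fin.init_snoc, Fin.snoc_last, if_true, one_ne_zero,
      if_false, Int.cast_one, Int.cast_neg] at h₀ h₁
    refine ⟨mul_right_cancel₀ hs ?_, mul_right_cancel₀ (mul_ne_zero Complex.I_ne_zero hs) ?_⟩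
    · linear_combination h₀
    · linear_combination -h₁
  constructor <;> funext i <;> obtain ⟨h₀, h₁⟩ := key i
  · linear_combination (h₀ + h₁) / 2
  · linear_combination (h₀ - h₁) / 2

theorem split_mem_DeltaSp_iff (n : ℕ) (hn : 1 ≤ n) (ε : ℤ) (x y : (Fin n → Fin 2) → ℂ) :
    tensP n x (uVec 1) + tensP n y (uVec (-1)) ∈ DeltaSp (n + 1) 1 ε ↔
      x ∈ DeltaSp n 0 ε ∧ y ∈ DeltaSp n 0 (-ε) := by
  have hI : (ε : ℂ) * Complex.I ^ (n + 1 + 1) = -(ε * Complex.I ^ (n + 0)) := by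
    linear_combination (ε : ℂ) * Complex.I ^ n * Complex.I_sq
  simp only [DeltaSp, Module.End.mem_eigenspace_iff, Matrix.toLin'_apply,
    gammaVol_succ_one_mulVec_split n hn, hI, smul_add, ← tensP_smul_left, Int.cast_neg,
    neg_mul]
  constructor
  · intro h
    obtain ⟨hx, hy⟩ := tensP_split_injective n h
    exact ⟨by simpa using hx, hy⟩
  · rintro ⟨hx, hy⟩
    simp only [hx, hy, neg_smul]

/-- `χ(γ_1 ⋯ γ_{2n+2} (x ⊗ u(1) + y ⊗ u(-1))) = (-ω' x, ω' y)` where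
`ω' = γ'_1 ⋯ γ'_{2n}`; consequently `χ` maps `Δ^±_{2n+2,1}` onto `Δ^±_{2n,0} ⊕ Δ^∓_{2n,0}`. -/
theorem gammaVol_action_on_split_spinors (n : ℕ) (hn : 1 ≤ n) :
    (∀ x y : (Fin n → Fin 2) → ℂ,
      (gammaVol (n + 1) 1).mulVec (tensP n x (uVec 1) + tensP n y (uVec (-1))) =
        tensP n (-(gammaVol n 0).mulVec x) (uVec 1) +
          tensP n ((gammaVol n 0).mulVec y) (uVec (-1))) ∧
    (∀ x y : (Fin n → Fin 2) → ℂ,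
      (tensP n x (uVec 1) + tensP n y (uVec (-1)) ∈ DeltaSp (n + 1) 1 1 ↔
        x ∈ DeltaSp n 0 1 ∧ y ∈ DeltaSp n 0 (-1))) ∧
    (∀ x y : (Fin n → Fin 2) → ℂ,
      (tensP n x (uVec 1) + tensP n y (uVec (-1)) ∈ DeltaSp (n + 1) 1 (-1) ↔
        x ∈ DeltaSp n 0 (-1) ∧ y ∈ DeltaSp n 0 1)) := by
  exact ⟨gammaVol_succ_one_mulVec_split n hn, split_mem_DeltaSp_iff n hn 1,
    fun x y => by simpa using split_mem_DeltaSp_iff n hn (-1) x y⟩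
end
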